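/- Let 0 < α < 1 and b_j := (j+1)^{1-α} − j^{1-α} for integers j ≥ 0. Let T > 0, δ > 0, D ≥ 0, and let (E_k)_{k≥0}, (G_k)_{k≥0} be sequences of nonnegative real numbers satisfying: E_0 ≤ G_0; E_1 ≤ E_0 + D + G_1; and for every integer k ≥ 1, E_{k+1} ≤ (1 − b_1) E_k + ∑_{j=1}^{k-1} (b_j − b_{j+1}) E_{k-j} + b_k E_0 + D + G_{k+1}. Then for every integer k ≥ 1 with k·δ ≤ T, E_k ≤ (2 T^α/(1 − α)) · δ^{−α} · (D + max_{0 ≤ j ≤ k} G_j). -/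

import Mathlib

/-- The L1 coefficients `b_j = (j+1)^(1-α) - j^(1-α)`. -/
noncomputable def bcoef (α : ℝ) (j : ℕ) : ℝ :=
  ((j : ℝ) + 1) ^ (1 - α) - (j : ℝ) ^ (1 - α)

/-- The graph of `t ↦ t ^ p`, `0 ≤ p ≤ 1`, lies below its tangent lines. -/
theorem rpow_le_tangent {p x y : ℝ} (hp0 : 0 ≤ p) (hp1 : p ≤ 1) (hx : 0 < x) (hy : 0 ≤ y) :
    y ^ p ≤ x ^ p + p * x ^ (p - 1) * (y - x) := by
  have hs : -1 ≤ y / x - 1 := by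
    have := div_nonneg hy hx.le
    linarith
  have h := rpow_one_add_le_one_add_mul_self hs hp0 hp1
  rw [add_sub_cancel, Real.div_rpow hy hx.le, div_le_iff₀ (Real.rpow_pos_of_pos hx p)] at h
  rw [Real.rpow_sub_one hx.ne']
  refine h.trans (le_of_eq ?_)
  field_simp

theorem mul_rpow_neg_le_bcoef {α : ℝ} (hα0 : 0 ≤ α) (hα1 : α ≤ 1) (j : ℕ) :
    (1 - α) * ((j : ℝ) + 1) ^ (-α) ≤ bcoef α j := by
  have h := rpow_le_tangent (p := 1 - α) (x := (j : ℝ) + 1) (y := j) (by linarith) (by linarith)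
    (by positivity) (by positivity)
  rw [show 1 - α - 1 = -α by ring] at h
  unfold bcoef
  linarith

theorem bcoef_succ_le_mul_rpow_neg {α : ℝ} (hα0 : 0 ≤ α) (hα1 : α ≤ 1) (j : ℕ) :
    bcoef α (j + 1) ≤ (1 - α) * ((j : ℝ) + 1) ^ (-α) := by
  have h := rpow_le_tangent (p := 1 - α) (x := (j : ℝ) + 1) (y := (j : ℝ) + 1 + 1)
    (by linarith) (by linarith) (by positivity) (by positivity)
  rw [show 1 - α - 1 = -α by ring] at h
  unfold bcoef
  push_cast
  linarith

theorem bcoef_pos {α : ℝ} (hα0 : 0 ≤ α) (hα1 : α < 1) (j : ℕ) : 0 < bcoef α j :=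
  (mul_pos (sub_pos.2 hα1) (Real.rpow_pos_of_pos (by positivity) _)).trans_le
    (mul_rpow_neg_le_bcoef hα0 hα1.le j)

theorem bcoef_antitone {α : ℝ} (hα0 : 0 ≤ α) (hα1 : α ≤ 1) : Antitone (bcoef α) :=
  antitone_nat_of_succ_le fun j =>
    (bcoef_succ_le_mul_rpow_neg hα0 hα1 j).trans (mul_rpow_neg_le_bcoef hα0 hα1 j)

theorem bcoef_zero {α : ℝ} (hα1 : α < 1) : bcoef α 0 = 1 := by
  simp [bcoef, Real.zero_rpow (sub_pos.2 hα1).ne']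

theorem sum_Ico_bcoef_sub (α : ℝ) {k : ℕ} (hk : 1 ≤ k) :
    ∑ j ∈ Finset.Ico 1 k, (bcoef α j - bcoef α (j + 1)) = bcoef α 1 - bcoef α k := by
  have h := Finset.sum_Ico_sub (bcoef α) hk
  rw [← neg_sub (bcoef α k), ← h, ← Finset.sum_neg_distrib]
  simp

/-- Discrete stability: the error is controlled by the data divided by the last coefficient. -/
theorem error_le_two_mul_div_bcoef {α D M : ℝ} (hα0 : 0 ≤ α) (hα1 : α < 1) (hD : 0 ≤ D)
    {E G : ℕ → ℝ} (hG : ∀ k, 0 ≤ G k)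
    (h0 : E 0 ≤ G 0) (h1 : E 1 ≤ E 0 + D + G 1)
    (hrec : ∀ k : ℕ, 1 ≤ k →
      E (k + 1) ≤ (1 - bcoef α 1) * E k
        + (∑ j ∈ Finset.Ico 1 k, (bcoef α j - bcoef α (j + 1)) * E (k - j))
        + bcoef α k * E 0 + D + G (k + 1))
    {N : ℕ} (hM : ∀ j ≤ N, D + G j ≤ M) (k : ℕ) (hk : k + 1 ≤ N) :
    E (k + 1) ≤ 2 * M / bcoef α k := by
  have hM0 : 0 ≤ M := (add_nonneg hD (hG 0)).trans (hM 0 (Nat.zero_le N))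
  have hE0 : E 0 ≤ M := by linarith [hM 0 (Nat.zero_le N)]
  have hanti := bcoef_antitone hα0 hα1.le
  have hle_one (j : ℕ) : bcoef α j ≤ 1 := bcoef_zero hα1 ▸ hanti (Nat.zero_le j)
  induction k using Nat.strong_induction_on with
  | _ k ih =>
    have hbk := bcoef_pos hα0 hα1 k
    have hGk := hM (k + 1) hk
    rcases Nat.eq_zero_or_pos k with rfl | hkpos
    · rw [bcoef_zero hα1]
      simp only [zero_add] at hGk ⊢
      linarith
    · have hprev (i : ℕ) (hi : 1 ≤ i) (hik : i ≤ k) : E i ≤ 2 * M / bcoef α k := by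
        obtain ⟨i, rfl⟩ := Nat.exists_eq_add_of_le' hi
        exact (ih i (by omega) (by omega)).trans
          (div_le_div_of_nonneg_left (by positivity) hbk (hanti (by omega)))
      have hsum : ∑ j ∈ Finset.Ico 1 k, (bcoef α j - bcoef α (j + 1)) * E (k - j) ≤
          (bcoef α 1 - bcoef α k) * (2 * M / bcoef α k) := by
        rw [← sum_Ico_bcoef_sub α hkpos, Finset.sum_mul]
        refine Finset.sum_le_sum fun j hj => ?_
        rw [Finset.mem_Ico] at hj
        exact mul_le_mul_of_nonneg_left (hprev _ (by omega) (by omega))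
          (sub_nonneg.2 (hanti j.le_succ))
      have hfirst : (1 - bcoef α 1) * E k ≤ (1 - bcoef α 1) * (2 * M / bcoef α k) :=
        mul_le_mul_of_nonneg_left (hprev k hkpos le_rfl) (sub_nonneg.2 (hle_one 1))
      have hlast : bcoef α k * E 0 ≤ M :=
        (mul_le_mul_of_nonneg_left hE0 hbk.le).trans (mul_le_of_le_one_left hM0 (hle_one k))
      have hcancel : bcoef α k * (2 * M / bcoef α k) = 2 * M := mul_div_cancel₀ _ hbk.ne'
      linarith [hrec k hkpos]


theorem full_discrete_error_stability (α : ℝ) (hα0 : 0 < α) (hα1 : α < 1)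
    (T δ D : ℝ) (hT : 0 < T) (hδ : 0 < δ) (hD : 0 ≤ D)
    (E G : ℕ → ℝ) (hE : ∀ k, 0 ≤ E k) (hG : ∀ k, 0 ≤ G k)
    (h0 : E 0 ≤ G 0) (h1 : E 1 ≤ E 0 + D + G 1)
    (hrec : ∀ k : ℕ, 1 ≤ k →
      E (k + 1) ≤ (1 - bcoef α 1) * E k
        + (∑ j ∈ Finset.Ico 1 k, (bcoef α j - bcoef α (j + 1)) * E (k - j))
        + bcoef α k * E 0 + D + G (k + 1)) :
    ∀ k : ℕ, 1 ≤ k → (k : ℝ) * δ ≤ T →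
      E k ≤ (2 * T ^ α / (1 - α)) * δ ^ (-α)
              * (D + (Finset.range (k + 1)).sup' (Finset.nonempty_range_iff.mpr k.succ_ne_zero) G) := by
  intro k hk hkT
  set M := D + (Finset.range (k + 1)).sup' (Finset.nonempty_range_iff.mpr k.succ_ne_zero) G with hMdef
  have hM : ∀ j ≤ k, D + G j ≤ M := fun j hj =>
    add_le_add_right (Finset.le_sup' G (Finset.mem_range.2 (Nat.lt_succ_of_le hj))) D
  have hM0 : 0 ≤ M := (add_nonneg hD (hG 0)).trans (hM 0 (Nat.zero_le k))
  clear_value M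
  obtain ⟨m, rfl⟩ := Nat.exists_eq_add_of_le' hk
  have hE := error_le_two_mul_div_bcoef hα0.le hα1 hD hG h0 h1 hrec hM m le_rfl
  have hα : 0 < 1 - α := sub_pos.2 hα1
  have hm : (0 : ℝ) < (m : ℝ) + 1 := by positivity
  push_cast at hkT
  have hpow : ((m : ℝ) + 1) ^ α ≤ T ^ α * δ ^ (-α) := by
    rw [Real.rpow_neg hδ.le, ← div_eq_mul_inv, ← Real.div_rpow hT.le hδ.le]
    exact Real.rpow_le_rpow hm.le ((le_div_iff₀ hδ).2 hkT) hα0.le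
  calc E (m + 1) ≤ 2 * M / bcoef α m := hE
    _ ≤ 2 * M / ((1 - α) * ((m : ℝ) + 1) ^ (-α)) :=
        div_le_div_of_nonneg_left (by positivity) (by positivity)
          (mul_rpow_neg_le_bcoef hα0.le hα1.le m)
    _ = 2 * M / (1 - α) * ((m : ℝ) + 1) ^ α := by
        rw [Real.rpow_neg hm.le]
        field_simp
    _ ≤ 2 * M / (1 - α) * (T ^ α * δ ^ (-α)) := by gcongr
    _ = 2 * T ^ α / (1 - α) * δ ^ (-α) * M := by ring
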